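/- In the net setting for distance-regular graphs with d → ∞ and Assumption (DR), for each fixed i ≥ 1 the net λ ↦ c_i(λ) of intersection numbers is eventually constant. -/

import Mathlib

open Matrix Filter

/-- A (bundled) distance-regular graph: a finite connected simple graph of diameter `d`
with intersection numbers `a i`, `b i`, `c i` for `0 ≤ i ≤ d`; `b 0` is the valency `k`. -/
structure DRG where
  X : Type
  fin : Fintype X
  G : SimpleGraph X
  d : ℕ
  a : ℕ → ℕ
  b : ℕ → ℕ
  c : ℕ → ℕ
  conn : G.Connected
  dist_le : ∀ x y : X, G.dist x y ≤ d
  dist_eq : ∃ x y : X, G.dist x y = d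
  bd : b d = 0
  c0 : c 0 = 0
  count_c : ∀ i ≤ d, ∀ x y : X, G.dist x y = i →
      {z : X | G.Adj y z ∧ G.dist x z = i - 1}.ncard = c i
  count_a : ∀ i ≤ d, ∀ x y : X, G.dist x y = i →
      {z : X | G.Adj y z ∧ G.dist x z = i}.ncard = a i
  count_b : ∀ i ≤ d, ∀ x y : X, G.dist x y = i →
      {z : X | G.Adj y z ∧ G.dist x z = i + 1}.ncard = b i

attribute [instance] DRG.fin

noncomputable instance (Γ : DRG) : DecidableEq Γ.X := Classical.decEq _

noncomputable instance (Γ : DRG) : DecidableRel Γ.G.Adj := fun _ _ => Classical.dec _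

namespace DRG

variable (Γ : DRG)

/-- The `i`-th distance matrix (over `ℂ`). -/
noncomputable def Amat (i : ℕ) : Matrix Γ.X Γ.X ℂ :=
  Matrix.of fun x y => if Γ.G.dist x y = i then 1 else 0

/-- The adjacency algebra `A(Γ) = span_ℂ {A_0, …, A_d}`. -/
noncomputable def adjAlg : Submodule ℂ (Matrix Γ.X Γ.X ℂ) :=
  Submodule.span ℂ {M | ∃ i ≤ Γ.d, M = Γ.Amat i}

/-- The matrix `K_t = (t^{∂(x,y)})_{x,y}` (over `ℝ`). -/
noncomputable def Kmat (t : ℝ) : Matrix Γ.X Γ.X ℝ :=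
  Matrix.of fun x y => t ^ Γ.G.dist x y

/-- `t ∈ π(Γ)`, i.e. `K_t` is positive semidefinite. -/
def piMem (t : ℝ) : Prop := (Γ.Kmat t).PosSemidef

/-- The Gibbs functional `φ_t(B) = ∑_x t^{∂(x,o)} B_{x,o}` with base vertex `o`. -/
noncomputable def gibbs (t : ℝ) (o : Γ.X) (B : Matrix Γ.X Γ.X ℂ) : ℂ :=
  ∑ x : Γ.X, (t : ℂ) ^ Γ.G.dist x o * B x o

end DRG

section Net

variable {Λ : Type*} [Preorder Λ] [IsDirected Λ (· ≤ ·)] [Nonempty Λ]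

/-- The variance `Σ_t²(A) = k(1−t)(1+t+t·a₁)` as a function of the net index. -/
noncomputable def sig2 (Γ : Λ → DRG) (t : Λ → ℝ) (l : Λ) : ℝ :=
  ((Γ l).b 0 : ℝ) * (1 - t l) * (1 + t l + t l * ((Γ l).a 1 : ℝ))

/-- `ω̄_i = c_i b_{i−1} / Σ_t²(A)`. -/
noncomputable def omegaBar (Γ : Λ → DRG) (t : Λ → ℝ) (i : ℕ) (l : Λ) : ℝ :=
  (((Γ l).c i : ℝ) * ((Γ l).b (i - 1) : ℝ)) / sig2 Γ t l

/-- `ᾱ_i = (a_{i−1} − t·k) / Σ_t(A)`. -/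
noncomputable def alphaBar (Γ : Λ → DRG) (t : Λ → ℝ) (i : ℕ) (l : Λ) : ℝ :=
  (((Γ l).a (i - 1) : ℝ) - t l * ((Γ l).b 0 : ℝ)) / Real.sqrt (sig2 Γ t l)

/-- `k_i = (b₀⋯b_{i−1})/(c₁⋯c_i)` as a real number. -/
noncomputable def kiProd (Γ : Λ → DRG) (i : ℕ) (l : Λ) : ℝ :=
  (∏ h ∈ Finset.range i, ((Γ l).b h : ℝ)) / (∏ h ∈ Finset.range i, ((Γ l).c (h + 1) : ℝ))

/-- `γ̄_i = t^i √(k_i)`. -/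
noncomputable def gammaBar (Γ : Λ → DRG) (t : Λ → ℝ) (i : ℕ) (l : Λ) : ℝ :=
  t l ^ i * Real.sqrt (kiProd Γ i l)

/-- Assumption (DR): for every `i ≥ 1` the limits `ω_i = lim ω̄_i` and `α_i = lim ᾱ_i`
exist (with prescribed values `ω i`, `αl i`) and `ω_i > 0`. -/
def AssumptionDR (Γ : Λ → DRG) (t : Λ → ℝ) (ω αl : ℕ → ℝ) : Prop :=
  ∀ i : ℕ, 1 ≤ i → 0 < ω i ∧ Tendsto (omegaBar Γ t i) atTop (nhds (ω i)) ∧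
    Tendsto (alphaBar Γ t i) atTop (nhds (αl i))

end Net

namespace DRG

section Combinatorics

variable {Γ : DRG}

/-- The neighbours of `y` that are closer to `x` than `y` is. -/
def closer (Γ : DRG) (x y : Γ.X) : Set Γ.X :=
  {z | Γ.G.Adj y z ∧ Γ.G.dist x z + 1 = Γ.G.dist x y}

/-- The neighbours of `y` that are further away from `x` than `y` is. -/
def further (Γ : DRG) (x y : Γ.X) : Set Γ.X :=
  {z | Γ.G.Adj y z ∧ Γ.G.dist x z = Γ.G.dist x y + 1}

lemma dist_triangle (x y z : Γ.X) : Γ.G.dist x z ≤ Γ.G.dist x y + Γ.G.dist y z :=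
  Γ.conn.dist_triangle

lemma dist_adj_le {y z : Γ.X} (h : Γ.G.Adj y z) (x : Γ.X) :
    Γ.G.dist x z ≤ Γ.G.dist x y + 1 ∧ Γ.G.dist x y ≤ Γ.G.dist x z + 1 := by
  have h1 : Γ.G.dist y z = 1 := SimpleGraph.dist_eq_one_iff_adj.2 h
  have h2 := dist_triangle x y z
  have h3 := dist_triangle x z y
  rw [Γ.G.dist_comm (u := z)] at h3
  omega

lemma adj_dist_le {x y : Γ.X} (h : Γ.G.Adj x y) (z : Γ.X) :
    Γ.G.dist y z ≤ Γ.G.dist x z + 1 ∧ Γ.G.dist x z ≤ Γ.G.dist y z + 1 := by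
  simpa only [Γ.G.dist_comm (u := z)] using dist_adj_le h z

lemma ncard_closer (x y : Γ.X) : (Γ.closer x y).ncard = Γ.c (Γ.G.dist x y) := by
  rcases Nat.eq_zero_or_pos (Γ.G.dist x y) with h | h
  · have : Γ.closer x y = ∅ := by
      ext z
      simp [closer, h]
    rw [this, h, Γ.c0, Set.ncard_empty]
  · rw [← Γ.count_c _ (Γ.dist_le x y) x y rfl]
    congr 1
    ext z
    simp only [closer, Set.mem_ofPred_eq]
    exact and_congr_right fun _ => by omega

lemma ncard_further (x y : Γ.X) : (Γ.further x y).ncard = Γ.b (Γ.G.dist x y) :=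
  Γ.count_b _ (Γ.dist_le x y) x y rfl

lemma closer_nonempty {x y : Γ.X} (h : x ≠ y) : (Γ.closer x y).Nonempty := by
  obtain ⟨p, hp⟩ := (Γ.conn y x).exists_walk_length_eq_dist
  cases p with
  | nil => exact absurd rfl h
  | @cons _ z _ hyz q =>
    refine ⟨z, hyz, ?_⟩
    have h1 := SimpleGraph.dist_le q
    have h2 := dist_adj_le hyz x
    rw [SimpleGraph.Walk.length_cons] at hp
    rw [Γ.G.dist_comm (u := z)] at h1
    rw [Γ.G.dist_comm (u := y)] at hp
    omega

lemma exists_dist_eq {i : ℕ} (hi : i ≤ Γ.d) : ∃ x y : Γ.X, Γ.G.dist x y = i := by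
  induction hj : Γ.d - i generalizing i with
  | zero =>
    obtain ⟨x, y, h⟩ := Γ.dist_eq
    exact ⟨x, y, by omega⟩
  | succ n ih =>
    obtain ⟨x, y, h⟩ := ih (i := i + 1) (by omega) (by omega)
    obtain ⟨z, -, hz⟩ := closer_nonempty (x := x) (y := y) (by
      rintro rfl
      simp at h)
    exact ⟨x, z, by omega⟩

lemma c_pos {i : ℕ} (h1 : 1 ≤ i) (hi : i ≤ Γ.d) : 0 < Γ.c i := by
  obtain ⟨x, y, rfl⟩ := exists_dist_eq hi
  rw [← ncard_closer, Set.ncard_pos]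
  exact closer_nonempty (by rintro rfl; simp at h1)

lemma b_pos {i : ℕ} (hi : i < Γ.d) : 0 < Γ.b i := by
  obtain ⟨x, y, h⟩ := exists_dist_eq (Nat.succ_le_of_lt hi)
  obtain ⟨z, hyz, hz⟩ := closer_nonempty (x := x) (y := y) (by
    rintro rfl
    simp at h)
  obtain rfl : Γ.G.dist x z = i := by omega
  rw [← ncard_further, Set.ncard_pos]
  exact ⟨y, hyz.symm, by omega⟩

lemma closer_subset {x x' y : Γ.X} (hx : Γ.G.Adj x x')
    (h : Γ.G.dist x' y = Γ.G.dist x y + 1) : Γ.closer x y ⊆ Γ.closer x' y := by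
  rintro z ⟨hz, hd⟩
  refine ⟨hz, ?_⟩
  have h1 := adj_dist_le hx z
  have h2 := dist_adj_le hz x'
  omega

lemma further_subset {x x' y : Γ.X} (hx : Γ.G.Adj x x')
    (h : Γ.G.dist x' y = Γ.G.dist x y + 1) : Γ.further x' y ⊆ Γ.further x y := by
  rintro z ⟨hz, hd⟩
  refine ⟨hz, ?_⟩
  have h1 := adj_dist_le hx z
  have h2 := dist_adj_le hz x
  omega

lemma exists_adj_dist {i : ℕ} (hi : i + 1 ≤ Γ.d) :
    ∃ x x' y : Γ.X, Γ.G.Adj x x' ∧ Γ.G.dist x y = i ∧ Γ.G.dist x' y = i + 1 := by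
  obtain ⟨x', y, h⟩ := exists_dist_eq hi
  obtain ⟨x, hx, hd⟩ := closer_nonempty (x := y) (y := x') (by
    rintro rfl
    simp at h)
  refine ⟨x, x', y, hx.symm, ?_, h⟩
  simp only [Γ.G.dist_comm (u := y)] at hd
  omega

lemma c_le_succ {i : ℕ} (hi : i + 1 ≤ Γ.d) : Γ.c i ≤ Γ.c (i + 1) := by
  obtain ⟨x, x', y, hx, rfl, h⟩ := exists_adj_dist hi
  rw [← h, ← ncard_closer, ← ncard_closer]
  exact Set.ncard_le_ncard (closer_subset hx h)

lemma b_succ_le {i : ℕ} (hi : i + 1 ≤ Γ.d) : Γ.b (i + 1) ≤ Γ.b i := by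
  obtain ⟨x, x', y, hx, rfl, h⟩ := exists_adj_dist hi
  rw [← h, ← ncard_further, ← ncard_further]
  exact Set.ncard_le_ncard (further_subset hx h)

lemma c_le_of_le {i j : ℕ} (hij : i ≤ j) (hj : j ≤ Γ.d) : Γ.c i ≤ Γ.c j := by
  induction j, hij using Nat.le_induction with
  | base => exact le_rfl
  | succ j _ ih => exact (ih (by omega)).trans (c_le_succ hj)

lemma b_le_of_le {i j : ℕ} (hij : i ≤ j) (hj : j ≤ Γ.d) : Γ.b j ≤ Γ.b i := by
  induction j, hij using Nat.le_induction with
  | base => exact le_rfl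
  | succ j _ ih => exact (b_succ_le hj).trans (ih (by omega))

lemma c_one (hd : 1 ≤ Γ.d) : Γ.c 1 = 1 := by
  obtain ⟨x, y, h⟩ := exists_dist_eq hd
  suffices (Γ.closer x y).ncard = 1 by rwa [ncard_closer, h] at this
  refine Set.ncard_eq_one.2 ⟨x, ?_⟩
  ext z
  simp only [closer, h, Set.mem_ofPred_eq, Set.mem_singleton_iff]
  constructor
  · rintro ⟨-, hz⟩
    exact (Γ.conn.dist_eq_zero_iff.1 (by omega)).symm
  · rintro rfl
    exact ⟨(SimpleGraph.dist_eq_one_iff_adj.1 h).symm, by simp⟩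

lemma sum_eq_valency {i : ℕ} (hi : i ≤ Γ.d) :
    Γ.a i + Γ.b i + Γ.c i = Γ.b 0 := by
  obtain ⟨x, y, h⟩ := exists_dist_eq hi
  have hb : {z | Γ.G.Adj y z}.ncard = Γ.b 0 := by
    rw [← Γ.count_b 0 (Nat.zero_le _) y y (by simp)]
    congr 1
    ext z
    simp only [Set.mem_ofPred_eq, zero_add, SimpleGraph.dist_eq_one_iff_adj, and_self]
  have hu : {z | Γ.G.Adj y z} =
      ({z | Γ.G.Adj y z ∧ Γ.G.dist x z = i} ∪ Γ.further x y) ∪ Γ.closer x y := by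
    ext z
    simp only [further, closer, h, Set.mem_union, Set.mem_ofPred_eq]
    constructor
    · intro hz
      have := dist_adj_le hz x
      simp only [hz, true_and]
      omega
    · tauto
  rw [← hb, hu, Set.ncard_union_eq, Set.ncard_union_eq, Γ.count_a i hi x y h, ncard_further,
    ncard_closer, h]
  · rw [Set.disjoint_left]
    rintro z ⟨-, h1⟩ ⟨-, h2⟩
    omega
  · rw [Set.disjoint_left]
    rintro z (⟨-, h1⟩ | ⟨-, h1⟩) ⟨-, h2⟩ <;> omega

lemma a_zero : Γ.a 0 = 0 := by
  have := sum_eq_valency (Nat.zero_le Γ.d)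
  omega

/-- `S, …, R` is a range on which the intersection numbers are constant. -/
structure IsRun (Γ : DRG) (S R : ℕ) : Prop where
  le_d : R ≤ Γ.d
  c_eq : ∀ i, S ≤ i → i ≤ R → Γ.c i = Γ.c S
  b_eq : ∀ i, S ≤ i → i ≤ R → Γ.b i = Γ.b S

/-- The set `C` cannot be left through an edge at a vertex at distance in `[S, R)` from `o`. -/
def ClosedFar (Γ : DRG) (C : Set Γ.X) (o : Γ.X) (S R : ℕ) : Prop :=
  ∀ ⦃p q⦄, p ∈ C → S ≤ Γ.G.dist o p → Γ.G.dist o p < R → Γ.G.Adj p q → q ∈ C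

lemma closer_eq_of_subset {x x' y y' : Γ.X} (h : Γ.closer x y ⊆ Γ.closer x' y')
    (hc : Γ.c (Γ.G.dist x y) = Γ.c (Γ.G.dist x' y')) : Γ.closer x y = Γ.closer x' y' :=
  Set.eq_of_subset_of_ncard_le h (by rw [ncard_closer, ncard_closer, hc])

lemma further_eq_of_subset {x x' y y' : Γ.X} (h : Γ.further x y ⊆ Γ.further x' y')
    (hb : Γ.b (Γ.G.dist x y) = Γ.b (Γ.G.dist x' y')) : Γ.further x y = Γ.further x' y' :=
  Set.eq_of_subset_of_ncard_le h (by rw [ncard_further, ncard_further, hb])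

lemma exists_extension {C : Set Γ.X} {o p : Γ.X} {S R : ℕ} (hC : Γ.ClosedFar C o S R)
    (hR : R ≤ Γ.d) (hp : p ∈ C) (hS : S ≤ Γ.G.dist o p) (j : ℕ) (hj : Γ.G.dist o p + j ≤ R) :
    ∃ g ∈ C, Γ.G.dist o g = Γ.G.dist o p + j ∧ Γ.G.dist p g = j := by
  induction j with
  | zero => exact ⟨p, hp, by simp⟩
  | succ j ih =>
    obtain ⟨g, hg, h1, h2⟩ := ih (by omega)
    have hpos : 0 < (Γ.further o g).ncard := by
      rw [ncard_further]
      exact b_pos (by omega)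
    obtain ⟨g', ha, hd⟩ := Set.nonempty_of_ncard_ne_zero hpos.ne'
    refine ⟨g', hC hg (by omega) (by omega) ha, by omega, ?_⟩
    have h3 := dist_adj_le ha p
    have h4 := dist_triangle o p g'
    omega

lemma closedFar_univ (o : Γ.X) (S R : ℕ) : Γ.ClosedFar Set.univ o S R :=
  fun _ _ _ _ _ _ => trivial

lemma ClosedFar.exit {C : Set Γ.X} {o p t : Γ.X} {S R : ℕ} (hC : Γ.ClosedFar C o S R)
    (hp : p ∈ C) (ht : t ∉ C) (hR : Γ.G.dist o p + Γ.G.dist p t ≤ R) :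
    Γ.G.dist o p + 2 ≤ Γ.G.dist p t + S := by
  have hne : t ≠ p := by
    rintro rfl
    exact ht hp
  induction hn : Γ.G.dist p t generalizing p with
  | zero => exact absurd (Γ.conn.dist_eq_zero_iff.1 hn).symm hne
  | succ n ih =>
    by_cases hS : S ≤ Γ.G.dist o p
    · obtain ⟨s, hs, hd⟩ := closer_nonempty hne
      have hsC : s ∈ C := hC hp hS (by omega) hs
      have h1 := dist_adj_le hs o
      simp only [Γ.G.dist_comm (u := t)] at hd
      have := ih hsC (by omega) (by rintro rfl; exact ht hsC) (by omega)
      omega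
    · omega

lemma ClosedFar.closer_subset_of_tight {C : Set Γ.X} {o p t : Γ.X} {S R : ℕ}
    (hC : Γ.ClosedFar C o S R) (hp : p ∈ C) (ht : t ∉ C)
    (hR : Γ.G.dist o p + Γ.G.dist p t ≤ R) (hS : S ≤ Γ.G.dist o p)
    (h : Γ.G.dist o p + 2 = Γ.G.dist p t + S) : Γ.closer t p ⊆ Γ.closer o p := by
  rintro s ⟨hs, hd⟩
  have hne : p ≠ t := by
    rintro rfl
    exact ht hp
  have hpos := Γ.conn.pos_dist_of_ne hne
  have hsC : s ∈ C := hC hp hS (by omega) hs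
  have h1 := dist_adj_le hs o
  simp only [Γ.G.dist_comm (u := t)] at hd
  have := hC.exit hsC ht (by omega)
  exact ⟨hs, by omega⟩

lemma ClosedFar.mem_of_tight {C : Set Γ.X} {o p t s : Γ.X} {S R : ℕ}
    (hC : Γ.ClosedFar C o S R) (hp : p ∈ C) (ht : t ∉ C)
    (hR : Γ.G.dist o p + Γ.G.dist p t ≤ R)
    (h : Γ.G.dist o p + 2 = Γ.G.dist p t + S) (hs : s ∈ Γ.closer p t) :
    s ∈ C ∧ Γ.G.dist o s + 1 = S := by
  obtain ⟨hs, hd⟩ := hs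
  have hsC : s ∈ C := by
    by_contra hsC
    have := hC.exit hp hsC (by omega)
    omega
  refine ⟨hsC, ?_⟩
  have h1 := dist_triangle o s p
  have h2 := dist_triangle o p s
  rw [Γ.G.dist_comm (u := s)] at h1
  have h3 : Γ.G.dist o s < S := by
    by_contra h3
    exact ht (hC hsC (by omega) (by omega) hs.symm)
  omega

/-- The vertices that are closer to `x` than to its neighbour `y`. -/
def halfSpace (Γ : DRG) (x y : Γ.X) : Set Γ.X := {p | Γ.G.dist y p = Γ.G.dist x p + 1}

lemma closedFar_halfSpace {S R : ℕ} (hrun : Γ.IsRun S R) {x y : Γ.X} (hxy : Γ.G.Adj x y) :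
    Γ.ClosedFar (Γ.halfSpace x y) x S R := by
  intro p q (hp : _ = _) hS hR hpq
  change _ = _
  have hx := dist_adj_le hpq x
  have hy := dist_adj_le hpq y
  have hq := adj_dist_le hxy q
  have hb := further_eq_of_subset (further_subset hxy hp) (by
    rw [hp, hrun.b_eq _ hS hR.le, hrun.b_eq (_ + 1) (by omega) (by omega)])
  have hc := closer_eq_of_subset (closer_subset hxy hp) (by
    rw [hp, hrun.c_eq _ hS hR.le, hrun.c_eq (_ + 1) (by omega) (by omega)])
  have h1 : Γ.G.dist x q = Γ.G.dist x p + 1 → Γ.G.dist y q = Γ.G.dist y p + 1 := fun h =>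
    (hb.symm ▸ (⟨hpq, h⟩ : q ∈ Γ.further x p) : q ∈ Γ.further y p).2
  have h2 : Γ.G.dist y q + 1 = Γ.G.dist y p → Γ.G.dist x q + 1 = Γ.G.dist x p := fun h =>
    (hc.symm ▸ (⟨hpq, h⟩ : q ∈ Γ.closer y p) : q ∈ Γ.closer x p).2
  omega

/-- Moving `u` to a neighbour cannot swap its distances `S - 1` and `S` to adjacent `x` and `y`. -/
lemma IsRun.not_swap {S : ℕ} (hrun : Γ.IsRun S (3 * S)) (hS : 2 ≤ S) {x y u t : Γ.X}
    (hxy : Γ.G.Adj x y) (hut : Γ.G.Adj u t) (hxu : Γ.G.dist x u + 1 = S) (hyu : Γ.G.dist y u = S)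
    (hxt : Γ.G.dist x t = S) : Γ.G.dist y t + 1 ≠ S := by
  intro hyt
  obtain ⟨v, -, hyv, huv⟩ := exists_extension (closedFar_univ y S (3 * S)) hrun.le_d
    (Set.mem_univ u) hyu.ge (S - 1) (by omega)
  have h1 := dist_triangle x u v
  have h2 := adj_dist_le hxy v
  have h3 := dist_adj_le hut v
  rw [Γ.G.dist_comm (u := v) (v := u)] at h3
  have hW := closedFar_halfSpace hrun hxy
  have hv : v ∈ Γ.halfSpace x y := by
    change _ = _
    omega
  have ht : t ∉ Γ.halfSpace x y := by
    intro (h : _ = _)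
    omega
  have h4 := hW.exit hv ht (by omega)
  have key : ∀ s ∈ Γ.closer v t, Γ.G.dist y s = Γ.G.dist x s + 1 ∧ Γ.G.dist x s + 1 = S :=
    fun s hs => hW.mem_of_tight hv ht (by omega) (by omega) hs
  have heq : Γ.closer v t = Γ.closer x t :=
    closer_eq_of_subset (fun s hs => ⟨hs.1, by rw [(key s hs).2, hxt]⟩)
      (by rw [hxt]; congr 1; omega)
  obtain ⟨s, hs, hd⟩ := closer_nonempty (x := y) (y := t) (by
    rintro rfl
    simp only [SimpleGraph.dist_self] at hyt
    omega)
  have h5 := adj_dist_le hxy s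
  have h6 := dist_adj_le hs x
  have h7 := key s (heq ▸ ⟨hs, by omega⟩)
  omega

lemma IsRun.b_pred {S : ℕ} (hrun : Γ.IsRun S (3 * S)) (hS : 2 ≤ S) :
    Γ.b (S - 1) = Γ.b S := by
  have hle := hrun.le_d
  have hb := b_le_of_le (Γ := Γ) (Nat.sub_le S 1) (by omega)
  refine hb.antisymm' (not_lt.1 fun hlt => ?_)
  have not_subset : ∀ {x y u : Γ.X}, Γ.G.dist x u + 1 = S → Γ.G.dist y u = S →
      ∃ t ∈ Γ.further x u, t ∉ Γ.further y u := by
    intro x y u hxu hyu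
    refine Set.not_subset.1 fun h => hlt.not_ge ?_
    have := Set.ncard_le_ncard h
    rwa [ncard_further, ncard_further, hyu, show Γ.G.dist x u = S - 1 by omega] at this
  obtain ⟨x, y, u, hxy, hxu, hyu⟩ := exists_adj_dist (Γ := Γ) (i := S - 1) (by omega)
  rw [Nat.sub_add_cancel (by omega)] at hyu
  obtain ⟨t, ⟨hut, hxt⟩, hyt⟩ := not_subset (x := x) (by omega) hyu
  have hW := closedFar_halfSpace hrun hxy
  have ht : t ∉ Γ.halfSpace x y := fun (h : _ = _) => hyt ⟨hut, by omega⟩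
  obtain ⟨w, -, hyw, huw⟩ := exists_extension (closedFar_univ y S (3 * S)) hle
    (Set.mem_univ u) hyu.ge (S - 2) (by omega)
  obtain ⟨v, hwv, hyv⟩ := Set.nonempty_of_ncard_ne_zero (s := Γ.further y w) (by
    rw [ncard_further]
    exact (b_pos (by omega)).ne')
  have h1 := dist_triangle x u w
  have h2 := adj_dist_le hxy w
  have h3 := adj_dist_le hxy v
  have h4 := dist_adj_le hwv u
  have h5 := dist_adj_le hwv x
  have hv : v ∈ Γ.halfSpace x y := by
    change _ = _
    omega
  have h6 := adj_dist_le hut v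
  have h7 := adj_dist_le hut w
  rw [Γ.G.dist_comm (u := t)] at h6 h7
  have h8 := hW.exit hv ht (by omega)
  have h9 := adj_dist_le hwv t
  have heq : Γ.closer v t = Γ.closer x t :=
    closer_eq_of_subset (fun s hs => ⟨hs.1, by
      have := (hW.mem_of_tight hv ht (by omega) (by omega) hs).2
      omega⟩) (by congr 1; omega)
  obtain ⟨t', ⟨htt, hwt⟩, hvt⟩ := not_subset (x := w) (y := v) (u := t) (by omega) (by omega)
  have h10 := dist_adj_le htt v
  have h11 := adj_dist_le hwv t'
  have h12 := hrun.not_swap hS hwv htt (by omega) (by omega) (by omega)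
  have hvt' : Γ.G.dist v t' = S := by
    have : Γ.G.dist v t' ≠ Γ.G.dist v t + 1 := fun h => hvt ⟨htt, h⟩
    omega
  have h13 := dist_adj_le htt x
  have ht' : t' ∉ Γ.halfSpace x y := by
    intro h
    by_cases hx : S ≤ Γ.G.dist x t'
    · exact ht (hW h hx (by omega) htt.symm)
    · have : t' ∈ Γ.closer v t := heq ▸ ⟨htt, by omega⟩
      have := this.2
      omega
  have hsub := closer_eq_of_subset
    (hW.closer_subset_of_tight hv ht' (by omega) (by omega) (by omega)) (by
      rw [Γ.G.dist_comm, hvt', hrun.c_eq (Γ.G.dist x v) (by omega) (by omega)])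
  have : w ∈ Γ.closer t' v := hsub ▸ ⟨hwv.symm, by omega⟩
  have := this.2
  rw [Γ.G.dist_comm, Γ.G.dist_comm (u := t')] at this
  omega

lemma dist_eq_of_exit {S : ℕ} (hb : Γ.b (S - 1) = Γ.b S) {x y p q : Γ.X}
    (hxy : Γ.G.Adj x y) (hp : p ∈ Γ.halfSpace x y) (hx : Γ.G.dist x p + 1 = S)
    (hpq : Γ.G.Adj p q) (hq : q ∉ Γ.halfSpace x y) :
    Γ.G.dist x q + 1 = S ∧ Γ.G.dist y q + 1 = S := by
  change _ = _ at hp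
  change ¬ _ = _ at hq
  have heq := further_eq_of_subset (further_subset hxy hp) (by
    rw [hp, hx, ← hb]
    congr 1
    omega)
  have h1 : Γ.G.dist x q ≠ Γ.G.dist x p + 1 := fun h => by
    have : q ∈ Γ.further y p := heq ▸ ⟨hpq, h⟩
    have := this.2
    omega
  have h2 := dist_adj_le hpq x
  have h3 := dist_adj_le hpq y
  have h4 := adj_dist_le hxy q
  omega

lemma IsRun.closedFar_compl {S R : ℕ} (hrun : Γ.IsRun S R)
    (hb : Γ.b (S - 1) = Γ.b S) {x y : Γ.X} (hxy : Γ.G.Adj x y) :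
    Γ.ClosedFar (Γ.halfSpace x y)ᶜ x S R := by
  intro p q hp hS hR hpq hq
  have hp' : ¬ _ = _ := hp
  have hq' : _ = _ := hq
  have h1 := dist_adj_le hpq x
  have h2 := dist_adj_le hpq y
  have h3 := adj_dist_le hxy p
  by_cases h : S ≤ Γ.G.dist x q
  · exact hp (closedFar_halfSpace hrun hxy hq h (by omega) hpq.symm)
  · have := dist_eq_of_exit hb hxy hq (by omega) hpq.symm hp
    omega

lemma IsRun.dist_ne_of_walk {S : ℕ} (hrun : Γ.IsRun S (3 * S)) (hS : 2 ≤ S)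
    (hb : Γ.b (S - 1) = Γ.b S) {t u y x f : Γ.X} (htu : Γ.G.Adj t u) (hyx : Γ.G.Adj y x)
    (hxf : Γ.G.Adj x f) (hty : Γ.G.dist t y + 1 = S) (huy : Γ.G.dist u y = S)
    (htf : Γ.G.dist t f = S) : Γ.G.dist u f + 1 ≠ S := by
  intro huf
  have hW := closedFar_halfSpace hrun htu
  obtain ⟨v, -, huv, hyv⟩ := exists_extension (closedFar_univ u S (3 * S)) hrun.le_d
    (Set.mem_univ y) huy.ge (S - 2) (by omega)
  have h1 := dist_triangle t y v
  have h2 := adj_dist_le htu v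
  have hv : v ∈ Γ.halfSpace t u := by
    change _ = _
    omega
  have hf : f ∉ Γ.halfSpace t u := by
    intro (h : _ = _)
    omega
  have h3 := dist_adj_le hyx v
  have h4 := dist_adj_le hxf v
  rw [Γ.G.dist_comm (u := v) (v := y)] at h3
  have key : ∀ s ∈ Γ.closer v f, Γ.G.dist v f = S ∧ Γ.G.dist t s + 1 = S ∧
      Γ.G.dist u s + 1 = S := by
    rintro s ⟨hs, hd⟩
    have hsW := hrun.closedFar_compl hb htu hf htf.ge (by omega) hs
    have h5 := hW.exit hv hsW (by omega)
    obtain ⟨r, hr⟩ := closer_nonempty (x := v) (y := s) (by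
      rintro rfl
      exact hsW hv)
    have h6 := hW.mem_of_tight hv hsW (by omega) (by omega) hr
    exact ⟨by omega, dist_eq_of_exit hb htu h6.1 h6.2 hr.1.symm hsW⟩
  obtain ⟨s₀, hs₀⟩ := closer_nonempty (x := v) (y := f) (by
    rintro rfl
    exact hf hv)
  have heq : Γ.closer v f = Γ.closer t f :=
    closer_eq_of_subset (fun s hs => ⟨hs.1, by rw [(key s hs).2.1, htf]⟩)
      (by rw [(key s₀ hs₀).1, htf])
  obtain ⟨s, hs, hd⟩ := closer_nonempty (x := u) (y := f) (by
    rintro rfl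
    simp only [SimpleGraph.dist_self] at huf
    omega)
  have h5 := adj_dist_le htu s
  have h6 := dist_adj_le hs t
  have := key s (heq ▸ ⟨hs, by omega⟩)
  omega

lemma IsRun.dist_ne_of_walk' {S : ℕ} (hrun : Γ.IsRun S (3 * S)) (hS : 2 ≤ S)
    (hb : Γ.b (S - 1) = Γ.b S) {t u y x f : Γ.X} (htu : Γ.G.Adj t u) (hyx : Γ.G.Adj y x)
    (hxf : Γ.G.Adj x f) (hty : Γ.G.dist t y + 1 = S) (huy : Γ.G.dist u y = S)
    (htf : Γ.G.dist t f = S) : Γ.G.dist u f ≠ S := by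
  intro huf
  have hE : Γ.ClosedFar {p | Γ.G.dist t p = Γ.G.dist u p} t S (3 * S) := by
    intro p q (hp : _ = _) h1 h2 hpq
    have h3 : ¬ _ = _ := hrun.closedFar_compl hb htu
      (fun (h : _ = _) => by omega) h1 h2 hpq
    have h4 : ¬ _ = _ := hrun.closedFar_compl hb htu.symm
      (fun (h : _ = _) => by omega) (hp ▸ h1) (hp ▸ h2) hpq
    have h5 := adj_dist_le htu q
    change _ = _
    omega
  obtain ⟨g, hg, htg, hfg⟩ := exists_extension hE hrun.le_d (p := f) (htf.trans huf.symm)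
    htf.ge (S - 2) (by omega)
  have hy : y ∉ {p | Γ.G.dist t p = Γ.G.dist u p} := fun (h : _ = _) => by omega
  have h1 := dist_adj_le hxf.symm g
  have h2 := dist_adj_le hyx.symm g
  rw [Γ.G.dist_comm (u := g) (v := f)] at h1
  have h3 := hE.exit hg hy (by omega)
  have key : ∀ s ∈ Γ.closer g y, Γ.G.dist t s = Γ.G.dist u s ∧ Γ.G.dist t s + 1 = S :=
    fun s hs => hE.mem_of_tight hg hy (by omega) (by omega) hs
  have heq : Γ.closer g y = Γ.closer u y :=
    closer_eq_of_subset (fun s hs => ⟨hs.1, by have := key s hs; omega⟩) (by congr 1; omega)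
  obtain ⟨s, hs, hd⟩ := closer_nonempty (x := t) (y := y) (by
    rintro rfl
    simp only [SimpleGraph.dist_self] at hty
    omega)
  have h4 := adj_dist_le htu s
  have h5 := dist_adj_le hs u
  have := key s (heq ▸ ⟨hs, by omega⟩)
  omega

lemma IsRun.c_pred {S : ℕ} (hrun : Γ.IsRun S (3 * S)) (hS : 2 ≤ S) :
    Γ.c (S - 1) = Γ.c S := by
  have hle := hrun.le_d
  have hb := hrun.b_pred hS
  obtain ⟨x, y, u, hxy, hxu, hyu⟩ := exists_adj_dist (Γ := Γ) (i := S - 1) (by omega)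
  rw [Nat.sub_add_cancel (by omega)] at hyu
  refine (c_le_of_le (Nat.sub_le S 1) (by omega)).antisymm ?_
  suffices h : Γ.closer y u ⊆ Γ.closer x u by
    simpa only [ncard_closer, hxu, hyu] using Set.ncard_le_ncard h
  intro t ht
  by_contra htx
  obtain ⟨hut, hyt⟩ := ht
  have hxt : ¬ Γ.G.dist x t + 1 = Γ.G.dist x u := fun h => htx ⟨hut, h⟩
  have h1 := (dist_eq_of_exit (x := x) (y := y) (p := u) (q := t) hb hxy
    (show _ = _ by omega) (by omega) hut (fun (h : _ = _) => by omega)).1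
  obtain ⟨f, hxf, htf⟩ := Set.nonempty_of_ncard_ne_zero (s := Γ.further t x) (by
    rw [ncard_further, Γ.G.dist_comm]
    exact (b_pos (by omega)).ne')
  rw [Γ.G.dist_comm] at hyt hyu hxu h1
  rw [Γ.G.dist_comm (u := y) (v := u)] at hyt
  have h2 := hrun.dist_ne_of_walk hS hb hut.symm hxy.symm hxf (by omega) (by omega) (by omega)
  have h3 := hrun.dist_ne_of_walk' hS hb hut.symm hxy.symm hxf (by omega) (by omega) (by omega)
  have h4 := dist_adj_le hxf u
  have h5 := adj_dist_le hut f
  omega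

/-- A run `n, …, 3n` of constant intersection numbers forces `c n = 1`. -/
lemma IsRun.c_eq_one {n : ℕ} (hn : 1 ≤ n) (hrun : Γ.IsRun n (3 * n)) : Γ.c n = 1 := by
  induction n, hn using Nat.le_induction with
  | base => exact c_one (le_trans (by omega) hrun.le_d)
  | succ n hn ih =>
    have hc : Γ.c n = Γ.c (n + 1) := hrun.c_pred (by omega)
    have hb : Γ.b n = Γ.b (n + 1) := hrun.b_pred (by omega)
    rw [← hc]
    refine ih ⟨le_trans (by omega) hrun.le_d, fun i hi hi' => ?_, fun i hi hi' => ?_⟩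
    · rcases hi.eq_or_lt with rfl | hi
      · rfl
      · rw [hc, hrun.c_eq i hi (by omega)]
    · rcases hi.eq_or_lt with rfl | hi
      · rfl
      · rw [hb, hrun.b_eq i hi (by omega)]

/-- If the valency is bounded and the diameter is large, then `c i = 1`. -/
lemma exists_diameter_bound (K i : ℕ) (hi : 1 ≤ i) :
    ∃ D, ∀ Γ : DRG, Γ.b 0 ≤ K → D ≤ Γ.d → Γ.c i = 1 := by
  refine ⟨3 ^ (2 * K + 1) * i, fun Γ hK hD => ?_⟩
  have hmono : ∀ j ≤ 2 * K + 1, 3 ^ j * i ≤ Γ.d := fun j hj =>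
    le_trans (Nat.mul_le_mul_right i (Nat.pow_le_pow_right (by norm_num) hj)) hD
  have hval : ∀ j ≤ Γ.d, Γ.c j ≤ K ∧ Γ.b j ≤ K := fun j hj => by
    have := sum_eq_valency hj
    omega
  obtain ⟨j, hj, hc, hb⟩ : ∃ j ≤ 2 * K, Γ.c (3 ^ (j + 1) * i) = Γ.c (3 ^ j * i) ∧
      Γ.b (3 ^ (j + 1) * i) = Γ.b (3 ^ j * i) := by
    by_contra! hne
    have hgrow : ∀ j ≤ 2 * K + 1,
        j + Γ.b (3 ^ j * i) ≤ Γ.c (3 ^ j * i) + K := by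
      intro j hj
      induction j with
      | zero =>
        have := hval (3 ^ 0 * i) (hmono 0 hj)
        omega
      | succ j ih =>
        have h1 := ih (by omega)
        have h2 := hne j (by omega)
        have hle : 3 ^ j * i ≤ 3 ^ (j + 1) * i :=
          Nat.mul_le_mul_right i (Nat.pow_le_pow_right (by norm_num) (Nat.le_succ j))
        have h3 := c_le_of_le hle (hmono _ hj)
        have h4 := b_le_of_le hle (hmono _ hj)
        omega
    have h1 := hgrow (2 * K + 1) le_rfl
    have h2 := hval _ (hmono (2 * K + 1) le_rfl)
    omega
  have hle := hmono (j + 1) (by omega)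
  have hthree : 3 ^ (j + 1) * i = 3 * (3 ^ j * i) := by ring
  rw [hthree] at hc hb hle
  have hpos : i ≤ 3 ^ j * i := Nat.le_mul_of_pos_left i (by positivity)
  have hrun : Γ.IsRun (3 ^ j * i) (3 * (3 ^ j * i)) :=
    ⟨hle, fun l h1 h2 => ((c_le_of_le h2 hle).trans hc.le).antisymm (c_le_of_le h1 (h2.trans hle)),
      fun l h1 h2 => (b_le_of_le h1 (h2.trans hle)).antisymm (hb.ge.trans (b_le_of_le h2 hle))⟩
  have h1 := hrun.c_eq_one (hi.trans hpos)
  have h2 := c_le_of_le hpos (by omega : 3 ^ j * i ≤ Γ.d)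
  have h3 := c_pos (Γ := Γ) hi (by omega)
  omega

end Combinatorics

end DRG

section Limits

variable {Λ : Type*} {F : Filter Λ} {Γ : Λ → DRG}

lemma eventually_eq_of_tendsto_natCast [F.NeBot] {f : Λ → ℕ} {r : ℝ}
    (h : Tendsto (fun l => (f l : ℝ)) F (nhds r)) : ∃ m, ∀ᶠ l in F, f l = m := by
  obtain ⟨m, rfl⟩ := Nat.isClosedEmbedding_coe_real.isClosed_range.mem_of_tendsto h
    (Eventually.of_forall fun l => Set.mem_range_self _)
  have := Nat.isClosedEmbedding_coe_real.isInducing.tendsto_nhds_iff.2 h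
  rw [nhds_discrete, tendsto_pure] at this
  exact ⟨m, this⟩

/-- If the valency tends to infinity, then `b i / k → 1` and each `c i` is eventually constant. -/
lemma eventually_c_eq_of_valency_atTop [F.NeBot] {r : ℕ → ℝ}
    (hd : Tendsto (fun l => (Γ l).d) F atTop)
    (hk : Tendsto (fun l => ((Γ l).b 0 : ℝ)) F atTop)
    (hcb : ∀ i, Tendsto (fun l => ((Γ l).c (i + 1) * (Γ l).b i / (Γ l).b 0 : ℝ)) F (nhds (r i)))
    (ha : ∀ i, ∃ M : ℝ, ∀ᶠ l in F, ((Γ l).a i : ℝ) ^ 2 ≤ M * (Γ l).b 0) (i : ℕ) :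
    Tendsto (fun l => ((Γ l).b i / (Γ l).b 0 : ℝ)) F (nhds 1) ∧
      ∃ m, ∀ᶠ l in F, (Γ l).c i = m := by
  have hpos := hk.eventually_gt_atTop 0
  induction i with
  | zero =>
    exact ⟨tendsto_const_nhds.congr' (hpos.mono fun l hl => (div_self hl.ne').symm),
      0, Eventually.of_forall fun l => (Γ l).c0⟩
  | succ i ih =>
    obtain ⟨m, hm⟩ : ∃ m, ∀ᶠ l in F, (Γ l).c (i + 1) = m := by
      refine eventually_eq_of_tendsto_natCast (((hcb i).div ih.1 one_ne_zero).congr' ?_)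
      filter_upwards [hpos, hd.eventually_gt_atTop i] with l hl hi
      have : (0 : ℝ) < (Γ l).b i := by exact_mod_cast DRG.b_pos hi
      simp only [Pi.div_apply]
      field_simp
    refine ⟨?_, m, hm⟩
    have hinv := tendsto_inv_atTop_zero.comp hk
    obtain ⟨M, hM⟩ := ha (i + 1)
    have ha0 : Tendsto (fun l => ((Γ l).a (i + 1) / (Γ l).b 0 : ℝ)) F (nhds 0) := by
      have hsqrt : Tendsto (fun l => Real.sqrt (M * ((Γ l).b 0 : ℝ)⁻¹)) F (nhds 0) := by
        have := (hinv.const_mul M).sqrt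
        rwa [mul_zero, Real.sqrt_zero] at this
      refine squeeze_zero' (Eventually.of_forall fun l => by positivity) ?_ hsqrt
      filter_upwards [hpos, hM] with l hl hl'
      refine Real.le_sqrt_of_sq_le ?_
      rw [div_pow, div_le_iff₀ (by positivity)]
      refine hl'.trans_eq ?_
      field_simp
    have hlim := (tendsto_const_nhds (x := (1 : ℝ))).sub (ha0.add (hinv.const_mul (m : ℝ)))
    rw [mul_zero, add_zero, sub_zero] at hlim
    refine hlim.congr' ?_
    filter_upwards [hpos, hm, hd.eventually_ge_atTop (i + 1)] with l hl hml hdl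
    have hsum : ((Γ l).a (i + 1) + (Γ l).b (i + 1) + (Γ l).c (i + 1) : ℝ) = (Γ l).b 0 := by
      exact_mod_cast DRG.sum_eq_valency hdl
    rw [hml] at hsum
    simp only [Function.comp]
    field_simp
    linarith

/-- If the valency does not tend to infinity, then it is eventually bounded. -/
lemma eventually_valency_le {r : ℝ} {K : ℕ}
    (hd : Tendsto (fun l => (Γ l).d) F atTop) (hk : ∃ᶠ l in F, (Γ l).b 0 ≤ K)
    (hcb : Tendsto (fun l => ((Γ l).c 2 * (Γ l).b 1 / (Γ l).b 0 : ℝ)) F (nhds r))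
    (ha : ∃ M : ℝ, ∀ᶠ l in F, ((Γ l).a 1 : ℝ) ^ 2 ≤ M * (Γ l).b 0) :
    ∃ K' : ℕ, ∀ᶠ l in F, (Γ l).b 0 ≤ K' := by
  have hsum : ∀ l, 2 ≤ (Γ l).d → 1 ≤ (Γ l).b 0 ∧ (Γ l).a 1 + (Γ l).b 1 + 1 = (Γ l).b 0 := by
    intro l hl
    have h1 := DRG.sum_eq_valency (Γ := Γ l) (i := 1) (by omega)
    rw [DRG.c_one (by omega)] at h1
    omega
  have hd2 := hd.eventually_ge_atTop 2
  obtain ⟨D, hD⟩ := DRG.exists_diameter_bound K 2 (by norm_num)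
  have hK : (0 : ℝ) < K := by
    obtain ⟨l, hl, hl'⟩ := (hk.and_eventually hd2).exists
    have := hsum l hl'
    exact_mod_cast (by omega : 0 < K)
  have hr : r ≤ 1 - 1 / K := by
    refine isClosed_Iic.mem_of_frequently_of_tendsto
      ((hk.and_eventually (hd2.and (hd.eventually_ge_atTop D))).mono ?_) hcb
    rintro l ⟨hl, hl2, hlD⟩
    obtain ⟨h1, h2⟩ := hsum l hl2
    have h1' : (1 : ℝ) ≤ (Γ l).b 0 := by exact_mod_cast h1
    have h2' : ((Γ l).b 1 : ℝ) + 1 ≤ (Γ l).b 0 := by exact_mod_cast (by omega)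
    have hl' : ((Γ l).b 0 : ℝ) ≤ K := by exact_mod_cast hl
    have h3 : (1 : ℝ) / K ≤ 1 / (Γ l).b 0 := one_div_le_one_div_of_le (by linarith) hl'
    rw [Set.mem_Iic, hD _ hl hlD, Nat.cast_one, one_mul]
    calc ((Γ l).b 1 / (Γ l).b 0 : ℝ) ≤ ((Γ l).b 0 - 1) / (Γ l).b 0 := by gcongr; linarith
      _ = 1 - 1 / (Γ l).b 0 := by field_simp
      _ ≤ _ := by linarith
  obtain ⟨M, hM⟩ := ha
  refine ⟨⌈8 * (K : ℝ) ^ 2 * (1 + |M|)⌉₊, ?_⟩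
  have hlt : r < 1 - 1 / (2 * K) := by
    have : (1 : ℝ) / (2 * K) < 1 / K := one_div_lt_one_div_of_lt hK (by linarith)
    linarith
  filter_upwards [hcb.eventually (gt_mem_nhds hlt), hd2, hM] with l hl hl2 hlM
  obtain ⟨h1, h2⟩ := hsum l hl2
  have h1' : (1 : ℝ) ≤ (Γ l).b 0 := by exact_mod_cast h1
  have h2' : ((Γ l).a 1 + (Γ l).b 1 + 1 : ℝ) = (Γ l).b 0 := by exact_mod_cast h2
  have hc : (1 : ℝ) ≤ (Γ l).c 2 := by
    exact_mod_cast DRG.c_pos (Γ := Γ l) (i := 2) (by norm_num) hl2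
  have hk0 : (0 : ℝ) < (Γ l).b 0 := by linarith
  rw [div_lt_iff₀ hk0] at hl
  have hb : ((Γ l).b 1 : ℝ) ≤ (Γ l).c 2 * (Γ l).b 1 :=
    le_mul_of_one_le_left (Nat.cast_nonneg _) hc
  have h3 : ((Γ l).b 0 : ℝ) < 2 * K * (1 + (Γ l).a 1) := by
    have : (1 / (2 * K) : ℝ) * (Γ l).b 0 < 1 + (Γ l).a 1 := by linarith
    rw [one_div, inv_mul_lt_iff₀ (by positivity)] at this
    exact this
  have h4 : ((Γ l).b 0 : ℝ) * (Γ l).b 0 ≤ 8 * (K : ℝ) ^ 2 * (1 + |M|) * (Γ l).b 0 := by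
    have hM' : M * ((Γ l).b 0 : ℝ) ≤ |M| * (Γ l).b 0 := by gcongr; exact le_abs_self M
    calc ((Γ l).b 0 : ℝ) * (Γ l).b 0
        ≤ (2 * K * (1 + (Γ l).a 1)) * (2 * K * (1 + (Γ l).a 1)) := by gcongr
      _ = 4 * (K : ℝ) ^ 2 * (1 + (Γ l).a 1) ^ 2 := by ring
      _ ≤ 4 * (K : ℝ) ^ 2 * (2 * (1 + |M|) * (Γ l).b 0) := by
        gcongr
        nlinarith [sq_nonneg (1 - ((Γ l).a 1 : ℝ))]
      _ = _ := by ring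
  exact_mod_cast (le_of_mul_le_mul_right h4 hk0).trans (Nat.le_ceil _)

end Limits

/-- Under Assumption (DR), each intersection number `c_i` (`i ≥ 1`) is eventually
constant along the net. -/
theorem stmt12 {Λ : Type*} [Preorder Λ] [IsDirected Λ (· ≤ ·)] [Nonempty Λ] [Infinite Λ]
    (Γ : Λ → DRG) (t : Λ → ℝ)
    (hpi : ∀ l : Λ, (Γ l).piMem (t l))
    (hvar : ∀ l : Λ, 0 < sig2 Γ t l)
    (hd : Tendsto (fun l : Λ => (Γ l).d) atTop atTop)
    (ω αl : ℕ → ℝ) (hDR : AssumptionDR Γ t ω αl) :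
    ∀ i : ℕ, 1 ≤ i → ∃ m : ℕ, ∀ᶠ l in (atTop : Filter Λ), (Γ l).c i = m := by
  have hk : ∀ l, (0 : ℝ) < (Γ l).b 0 := fun l => by
    refine lt_of_le_of_ne (Nat.cast_nonneg _) fun h => (hvar l).ne ?_
    simp only [sig2, ← h, zero_mul]
  have hω : ω 1 ≠ 0 := (hDR 1 le_rfl).1.ne'
  have hkσ : Tendsto (fun l => ((Γ l).b 0 : ℝ) / sig2 Γ t l) atTop (nhds (ω 1)) := by
    refine (hDR 1 le_rfl).2.1.congr' ?_
    filter_upwards [hd.eventually_ge_atTop 1] with l hl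
    simp [omegaBar, DRG.c_one hl]
  have hcb : ∀ i, Tendsto (fun l => ((Γ l).c (i + 1) * (Γ l).b i / (Γ l).b 0 : ℝ)) atTop
      (nhds (ω (i + 1) / ω 1)) := fun i => by
    refine ((hDR (i + 1) (by omega)).2.1.div hkσ hω).congr fun l => ?_
    have := (hvar l).ne'
    have := (hk l).ne'
    simp only [Pi.div_apply, omegaBar, Nat.add_sub_cancel]
    field_simp
  have ha : ∀ i, ∃ M : ℝ, ∀ᶠ l in atTop, ((Γ l).a i : ℝ) ^ 2 ≤ M * (Γ l).b 0 := fun i => by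
    have hlim := (((hDR (i + 1) (by omega)).2.2.sub (hDR 1 le_rfl).2.2).pow 2).div hkσ hω
    obtain ⟨M, hM⟩ := exists_gt (((αl (i + 1) - αl 1) ^ 2) / ω 1)
    refine ⟨M, (hlim.eventually (gt_mem_nhds hM)).mono fun l hl => ?_⟩
    have hσ := hvar l
    rw [← div_le_iff₀ (hk l)]
    refine le_of_eq_of_le ?_ hl.le
    simp only [Pi.div_apply, alphaBar, Nat.add_sub_cancel, Nat.sub_self, DRG.a_zero, ← sub_div,
      div_pow, Real.sq_sqrt hσ.le]
    have := (hk l).ne'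
    field_simp
    push_cast
    ring
  intro i hi
  by_cases hinf : Tendsto (fun l => (Γ l).b 0) atTop atTop
  · exact (eventually_c_eq_of_valency_atTop hd (tendsto_natCast_atTop_atTop.comp hinf)
      hcb ha i).2
  · obtain ⟨K, hK⟩ : ∃ K, ∃ᶠ l in atTop, (Γ l).b 0 ≤ K := by
      by_contra! h
      exact hinf (tendsto_atTop.2 fun K => (h K).mono fun l => le_of_lt)
    obtain ⟨K', hK'⟩ := eventually_valency_le hd hK (hcb 1) (ha 1)
    obtain ⟨D, hD⟩ := DRG.exists_diameter_bound K' i hi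
    refine ⟨1, ?_⟩
    filter_upwards [hK', hd.eventually_ge_atTop D] with l h1 h2
    exact hD _ h1 h2
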